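/- arXiv:2305.12413 — 2 statements merged into one kernel-verified Lean document; each statement's English description precedes it below -/
import Mathlib

section
/- Leading asymptotics of the discrepancy integral against the true invariant density: with K₀ and p_Γ as defined in the context, lim_{Γ → ∞} Γ · ∫_ℝ ∫_ℝ (1 + e^{|l + r|})^{−1} p_Γ(l) p_Γ(r) dl dr = log 2. -/
open MeasureTheory Filter

/-- The modified Bessel function of the second kind of order 0:
`K₀ x = (1/2) ∫₀^∞ y⁻¹ exp(−(x/2)(y + 1/y)) dy`. -/
noncomputable def K0 (x : ℝ) : ℝ :=
  (1 / 2) * ∫ y in Set.Ioi (0 : ℝ), y⁻¹ * Real.exp (-(x / 2) * (y + 1 / y))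

/-- The invariant density `p_Γ(x) = exp(−(ε/2)(eˣ + e⁻ˣ)) / (2 K₀(ε))` with `ε = e^{−Γ}`. -/
noncomputable def pGamma (Γ x : ℝ) : ℝ :=
  Real.exp (-(Real.exp (-Γ) / 2) * (Real.exp x + Real.exp (-x))) / (2 * K0 (Real.exp (-Γ)))

noncomputable def gD (s : ℝ) : ℝ := (1 + Real.exp |s|)⁻¹

noncomputable def wD (Γ x : ℝ) : ℝ :=
  Real.exp (-(Real.exp (-Γ) / 2) * (Real.exp x + Real.exp (-x)))

lemma gD_integral : ∫ s : ℝ, gD s = 2 * Real.log 2 := by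
  unfold gD
  rw [integral_comp_abs (f := fun x => (1 + Real.exp x)⁻¹)]
  congr 1
  have h := integral_Ioi_of_hasDerivAt_of_nonneg' (a := (0 : ℝ)) (l := 0)
    (g := fun x => - Real.log (1 + Real.exp (-x))) (g' := fun x => (1 + Real.exp x)⁻¹)
    (fun x _ => by
      have h1 : HasDerivAt (fun x : ℝ => 1 + Real.exp (-x)) (Real.exp (-x) * (-1)) x :=
        ((hasDerivAt_neg x).exp).const_add 1
      have h2 := (h1.log (by positivity)).neg
      have e : -(Real.exp (-x) * (-1) / (1 + Real.exp (-x))) = (1 + Real.exp x)⁻¹ := by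
        rw [Real.exp_neg]
        have := Real.exp_pos x
        field_simp
        ring
      rw [e] at h2
      exact h2)
    (fun x _ => by positivity)
    (by
      have h1 : Tendsto (fun x : ℝ => 1 + Real.exp (-x)) atTop (nhds (1 + 0)) :=
        tendsto_const_nhds.add Real.tendsto_exp_neg_atTop_nhds_zero
      have h2 := (h1.log (by norm_num)).neg
      simpa using h2)
  rw [h]
  norm_num

lemma gD_integrable : Integrable gD := by
  apply Integrable.of_integral_ne_zero
  rw [gD_integral]
  have := Real.log_pos (by norm_num : (1 : ℝ) < 2)
  positivity

lemma gD_cont : Continuous gD := by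
  unfold gD
  refine Continuous.inv₀ (by fun_prop) (fun x => by positivity)

lemma gD_nonneg (s : ℝ) : 0 ≤ gD s := by unfold gD; positivity

lemma wD_cont (Γ : ℝ) : Continuous (wD Γ) := by unfold wD; fun_prop

lemma wD_pos (Γ x : ℝ) : 0 < wD Γ x := Real.exp_pos _

lemma wD_le_one (Γ x : ℝ) : wD Γ x ≤ 1 := by
  unfold wD
  rw [Real.exp_le_one_iff]
  have : 0 < (Real.exp (-Γ) / 2) * (Real.exp x + Real.exp (-x)) := by positivity
  linarith

lemma wD_eq (Γ x : ℝ) :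
    wD Γ x = Real.exp (-(1 / 2) * (Real.exp (x - Γ) + Real.exp (-x - Γ))) := by
  unfold wD
  rw [sub_eq_add_neg, sub_eq_add_neg, Real.exp_add, Real.exp_add]
  congr 1
  ring

lemma expabs_integrable :
    Integrable (fun x : ℝ => Real.exp (1 / 2) * Real.exp (-(1 / 2) * |x|)) := by
  apply Integrable.const_mul
  apply Integrable.of_integral_ne_zero
  rw [integral_comp_abs (f := fun x => Real.exp (-(1 / 2) * x)),
    integral_exp_mul_Ioi (by norm_num)]
  norm_num

lemma wD_bound (Γ u : ℝ) (hΓ : 1 ≤ Γ) :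
    wD Γ (Γ * u) ≤ Real.exp (1 / 2) * Real.exp (-(1 / 2) * |u|) := by
  rw [← Real.exp_add]
  rcases le_total |u| 1 with h | h
  · refine (wD_le_one _ _).trans ?_
    rw [Real.one_le_exp_iff]
    linarith
  · rw [wD_eq, Real.exp_le_exp]
    have key : |u| ≤ Real.exp (Γ * |u| - Γ) := by
      have := Real.add_one_le_exp (Γ * |u| - Γ)
      nlinarith
    have k2 : Real.exp (Γ * |u| - Γ) ≤ Real.exp (Γ * u - Γ) + Real.exp (-(Γ * u) - Γ) := by
      rcases abs_cases u with ⟨h, _⟩ | ⟨h, _⟩ <;> rw [h]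
      · linarith [Real.exp_pos (-(Γ * u) - Γ)]
      · rw [mul_neg]
        linarith [Real.exp_pos (Γ * u - Γ)]
    linarith

lemma wD_lim_one (s u : ℝ) (hu : |u| < 1) :
    Tendsto (fun Γ => wD Γ (s - Γ * u)) atTop (nhds 1) := by
  obtain ⟨h1, h2⟩ := abs_lt.1 hu
  simp only [wD_eq]
  have a1 : Tendsto (fun Γ : ℝ => Real.exp (s - Γ * u - Γ)) atTop (nhds 0) := by
    apply Real.tendsto_exp_atBot.comp
    have : Tendsto (fun Γ : ℝ => s + (-(1 + u)) * Γ) atTop atBot :=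
      tendsto_atBot_add_const_left _ _ (tendsto_id.const_mul_atTop_of_neg (by linarith))
    exact this.congr (fun x => by ring)
  have a2 : Tendsto (fun Γ : ℝ => Real.exp (-(s - Γ * u) - Γ)) atTop (nhds 0) := by
    apply Real.tendsto_exp_atBot.comp
    have : Tendsto (fun Γ : ℝ => -s + (u - 1) * Γ) atTop atBot :=
      tendsto_atBot_add_const_left _ _ (tendsto_id.const_mul_atTop_of_neg (by linarith))
    exact this.congr (fun x => by ring)
  have := (Real.continuous_exp.tendsto _).comp ((a1.add a2).const_mul (-(1 / 2 : ℝ)))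
  simpa [Function.comp_def] using this

lemma wD_neg (Γ x : ℝ) : wD Γ (-x) = wD Γ x := by
  unfold wD; rw [neg_neg, add_comm]

lemma wD_lim_zero (u : ℝ) (hu : 1 < |u|) :
    Tendsto (fun Γ => wD Γ (Γ * u)) atTop (nhds 0) := by
  have hb : ∀ Γ, wD Γ (Γ * u) ≤ Real.exp (-(1 / 2) * Real.exp (Γ * (|u| - 1))) := by
    intro Γ
    have : wD Γ (Γ * u) = wD Γ (Γ * |u|) := by
      rcases abs_cases u with ⟨h, _⟩ | ⟨h, _⟩ <;> rw [h]
      rw [mul_neg, wD_neg]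
    rw [this, wD_eq, Real.exp_le_exp, mul_sub, mul_one]
    linarith [Real.exp_pos (-(Γ * |u|) - Γ)]
  refine squeeze_zero (fun Γ => (wD_pos _ _).le) hb ?_
  apply Real.tendsto_exp_atBot.comp
  apply Tendsto.const_mul_atTop_of_neg (by norm_num)
  apply Real.tendsto_exp_atTop.comp
  exact tendsto_id.atTop_mul_const (by linarith)

lemma dct_main (J : ℝ → ℝ → ℝ) (C c : ℝ)
    (hm : ∀ Γ, AEStronglyMeasurable (J Γ) volume)
    (hb : ∀ Γ u, |J Γ u| ≤ C)
    (hl : ∀ u, |u| < 1 → Tendsto (fun Γ => J Γ u) atTop (nhds c)) :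
    Tendsto (fun Γ => ∫ u : ℝ, wD Γ (Γ * u) * J Γ u) atTop (nhds (2 * c)) := by
  have hint : ∫ u : ℝ, (Set.Ioo (-1 : ℝ) 1).indicator (fun _ => c) u = 2 * c := by
    rw [integral_indicator measurableSet_Ioo]
    simp
    norm_num
  rw [← hint]
  refine tendsto_integral_filter_of_dominated_convergence
    (fun u => (Real.exp (1 / 2) * Real.exp (-(1 / 2) * |u|)) * C) ?_ ?_
    (expabs_integrable.mul_const C) ?_
  · refine Eventually.of_forall fun Γ => ?_
    refine AEStronglyMeasurable.mul ?_ (hm Γ)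
    exact ((wD_cont Γ).comp (continuous_const.mul continuous_id)).aestronglyMeasurable
  · filter_upwards [eventually_ge_atTop 1] with Γ hΓ
    refine Eventually.of_forall fun u => ?_
    rw [norm_mul, Real.norm_of_nonneg (wD_pos _ _).le]
    exact mul_le_mul (wD_bound Γ u hΓ) (hb Γ u) (norm_nonneg _) (by positivity)
  · have hne : ∀ᵐ u : ℝ, u ≠ 1 ∧ u ≠ -1 := by
      refine (Measure.ae_ne volume 1).and (Measure.ae_ne volume (-1))
    filter_upwards [hne] with u hu
    by_cases h : |u| < 1
    · rw [Set.indicator_of_mem (show u ∈ Set.Ioo (-1 : ℝ) 1 from abs_lt.1 h)]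
      have h1 := wD_lim_one 0 u h
      simp only [zero_sub, wD_neg] at h1
      simpa using h1.mul (hl u h)
    · rw [Set.indicator_of_notMem (show u ∉ Set.Ioo (-1 : ℝ) 1 from fun h' => h (abs_lt.2 h'))]
      have h1 : 1 < |u| := by
        refine lt_of_le_of_ne (not_lt.1 h) (fun h' => ?_)
        rcases (abs_eq zero_le_one).1 h'.symm with h'' | h''
        · exact hu.1 h''
        · exact hu.2 h''
      have hz := (wD_lim_zero u h1).mul_const C
      rw [zero_mul] at hz
      refine squeeze_zero_norm (fun Γ => ?_) hz
      rw [norm_mul, Real.norm_of_nonneg (wD_pos _ _).le]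
      exact mul_le_mul_of_nonneg_left (hb Γ u) (wD_pos _ _).le

noncomputable def JD (Γ u : ℝ) : ℝ := ∫ s : ℝ, gD s * wD Γ (s - Γ * u)

lemma JD_lim (u : ℝ) (hu : |u| < 1) :
    Tendsto (fun Γ => JD Γ u) atTop (nhds (2 * Real.log 2)) := by
  rw [← gD_integral]
  refine tendsto_integral_filter_of_dominated_convergence gD ?_ ?_ gD_integrable ?_
  · refine Eventually.of_forall fun Γ => ?_
    exact (gD_cont.mul ((wD_cont Γ).comp (by fun_prop))).aestronglyMeasurable
  · refine Eventually.of_forall fun Γ => Eventually.of_forall fun s => ?_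
    rw [Real.norm_of_nonneg (mul_nonneg (gD_nonneg _) (wD_pos _ _).le)]
    exact mul_le_of_le_one_right (gD_nonneg _) (wD_le_one _ _)
  · refine Eventually.of_forall fun s => ?_
    simpa using (wD_lim_one s u hu).const_mul (gD s)

lemma JD_bound (Γ u : ℝ) : |JD Γ u| ≤ 2 * Real.log 2 := by
  rw [← gD_integral, ← Real.norm_eq_abs]
  refine norm_integral_le_of_norm_le gD_integrable (Eventually.of_forall fun s => ?_)
  rw [Real.norm_of_nonneg (mul_nonneg (gD_nonneg _) (wD_pos _ _).le)]
  exact mul_le_of_le_one_right (gD_nonneg _) (wD_le_one _ _)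

lemma JD_meas (Γ : ℝ) : AEStronglyMeasurable (JD Γ) volume := by
  have h : Continuous (Function.uncurry fun u s : ℝ => gD s * wD Γ (s - Γ * u)) :=
    (gD_cont.comp continuous_snd).mul ((wD_cont Γ).comp (by fun_prop))
  exact (h.stronglyMeasurable.integral_prod_right (ν := volume)).aestronglyMeasurable

lemma K0_eq (Γ : ℝ) : 2 * K0 (Real.exp (-Γ)) = ∫ x : ℝ, wD Γ x := by
  unfold K0
  have h := integral_image_eq_integral_abs_deriv_smul (s := Set.univ) (f := Real.exp)
    (f' := Real.exp) MeasurableSet.univ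
    (fun x _ => (Real.hasDerivAt_exp x).hasDerivWithinAt) Real.exp_injective.injOn
    (fun y => y⁻¹ * Real.exp (-(Real.exp (-Γ) / 2) * (y + 1 / y)))
  rw [Set.image_univ, Real.range_exp] at h
  rw [h, ← mul_assoc]
  norm_num
  refine integral_congr_ae (Eventually.of_forall fun x => ?_)
  have := Real.exp_ne_zero x
  simp only [wD, Real.exp_neg x]
  field_simp

lemma scale (Γ : ℝ) (hΓ : 0 < Γ) (f : ℝ → ℝ) : ∫ x : ℝ, f x = Γ * ∫ u : ℝ, f (Γ * u) := by
  rw [Measure.integral_comp_mul_left, abs_of_pos (by positivity), smul_eq_mul]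
  field_simp

lemma double_eq (Γ : ℝ) (hΓ : 0 < Γ) :
    Γ * ∫ l : ℝ, (∫ r : ℝ, (1 + Real.exp |l + r|)⁻¹ * pGamma Γ l * pGamma Γ r)
      = (∫ u : ℝ, wD Γ (Γ * u) * JD Γ u) / (∫ u : ℝ, wD Γ (Γ * u) * 1) ^ 2 := by
  have hin : ∀ l : ℝ, (∫ r : ℝ, (1 + Real.exp |l + r|)⁻¹ * pGamma Γ l * pGamma Γ r)
      = (wD Γ l * ∫ s : ℝ, gD s * wD Γ (s - l)) / (2 * K0 (Real.exp (-Γ))) ^ 2 := by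
    intro l
    rw [← integral_add_left_eq_self (fun s => gD s * wD Γ (s - l)) l,
      ← integral_const_mul, ← integral_div]
    refine integral_congr_ae (Eventually.of_forall fun r => ?_)
    simp only [pGamma, wD, gD, add_sub_cancel_left]
    ring
  simp_rw [hin]
  rw [integral_div, K0_eq, scale Γ hΓ (wD Γ), scale Γ hΓ]
  simp only [mul_one]
  change Γ * (Γ * (∫ u : ℝ, wD Γ (Γ * u) * JD Γ u) / _) = _
  rw [mul_pow, ← mul_div_assoc, ← mul_assoc, ← pow_two]
  exact mul_div_mul_left _ _ (by positivity)

/-- Leading asymptotics of the discrepancy integral against the true invariant density: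
`Γ · ∫_ℝ ∫_ℝ (1 + e^{|l+r|})⁻¹ p_Γ(l) p_Γ(r) dl dr → log 2` as `Γ → ∞`. -/
theorem discrepancy_integral_asymptotics :
    Tendsto (fun Γ : ℝ =>
        Γ * ∫ l : ℝ, (∫ r : ℝ, (1 + Real.exp |l + r|)⁻¹ * pGamma Γ l * pGamma Γ r))
      atTop (nhds (Real.log 2)) := by
  have h1 := dct_main JD _ _ JD_meas JD_bound JD_lim
  have h2 := dct_main (fun _ _ => 1) 1 1 (fun _ => aestronglyMeasurable_const)
    (fun _ _ => by simp) (fun _ _ => tendsto_const_nhds)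
  have h3 := h1.div (h2.pow 2) (by norm_num)
  have e : 2 * (2 * Real.log 2) / (2 * 1) ^ 2 = Real.log 2 := by ring
  rw [e] at h3
  refine h3.congr' ?_
  filter_upwards [eventually_gt_atTop 0] with Γ hΓ
  exact (double_eq Γ hΓ).symm
end

section
/- Second-order expansion of the discrepancy integral: with K₀ and p_Γ as defined in the context and γ the Euler–Mascheroni constant, there exist constants C > 0 and Γ₀ > 0 such that for all Γ ≥ Γ₀, | ∫_ℝ ∫_ℝ (1 + e^{|l + r|})^{−1} p_Γ(l) p_Γ(r) dl dr − (log 2)/Γ + (π²/24 + (3/2)(log 2)² − γ log 2)/Γ² | ≤ C/Γ³. -/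
open MeasureTheory Filter

section DiscAux
open Real Set Topology

lemma aux_gam : ∫ t in Ioi (0:ℝ), Real.log t * Real.exp (-t) = -Real.eulerMascheroniConstant := by
  have h1 := Complex.hasDerivAt_GammaIntegral (s := 1) (by simp)
  have h2 : HasDerivAt Complex.GammaIntegral (-(Real.eulerMascheroniConstant : ℂ)) 1 := by
    refine Complex.hasDerivAt_Gamma_one.congr_of_eventuallyEq ?_
    have : {s : ℂ | 0 < s.re} ∈ 𝓝 (1:ℂ) :=
      (isOpen_lt continuous_const Complex.continuous_re).mem_nhds (by simp)
    filter_upwards [this] with s hs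
    exact (Complex.Gamma_eq_integral hs).symm
  have h3 := h1.unique h2
  simp only [sub_self, Complex.cpow_zero, one_mul] at h3
  rw [← Complex.ofReal_inj, ← integral_complex_ofReal]
  push_cast
  push_cast at h3
  exact h3

lemma aux_gam_int : IntegrableOn (fun t => Real.log t * Real.exp (-t)) (Ioi (0:ℝ)) := by
  apply Integrable.of_integral_ne_zero
  rw [aux_gam]
  have := Real.one_half_lt_eulerMascheroniConstant
  intro h
  linarith

lemma aux_exp_abs {c : ℝ} (hc : 0 < c) : Integrable (fun x : ℝ => Real.exp (-(c * |x|))) := by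
  apply Integrable.of_integral_ne_zero
  rw [integral_comp_abs (f := fun x => Real.exp (-(c * x)))]
  have := integral_exp_mul_Ioi (a := -c) (by linarith) 0
  simp only [neg_mul] at this
  rw [this]
  simp [hc.ne']

noncomputable def WW (a x : ℝ) : ℝ := Real.exp (-(a / 2) * (Real.exp x + Real.exp (-x)))

lemma WW_cont (a : ℝ) : Continuous (WW a) := by unfold WW; fun_prop

lemma exp_sum_abs (x : ℝ) : Real.exp x + Real.exp (-x) = Real.exp |x| + Real.exp (-|x|) := by
  rcases abs_cases x with ⟨h, _⟩ | ⟨h, _⟩ <;> rw [h]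
  rw [neg_neg, add_comm]

lemma WW_int {a : ℝ} (ha : 0 < a) : Integrable (WW a) := by
  refine (aux_exp_abs (c := a/2) (by positivity)).mono' (WW_cont a).aestronglyMeasurable ?_
  refine ae_of_all _ fun x => ?_
  unfold WW
  rw [Real.norm_eq_abs, Real.abs_exp, exp_sum_abs]
  apply Real.exp_le_exp.2
  have h1 := Real.add_one_le_exp |x|
  have h2 := Real.exp_pos (-|x|)
  nlinarith

lemma WW_integral (a : ℝ) : ∫ x, WW a x = 2 * K0 a := by
  unfold K0
  have h := integral_image_eq_integral_abs_deriv_smul (s := univ) (f := Real.exp) (f' := Real.exp)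
    MeasurableSet.univ (fun x _ => (Real.hasDerivAt_exp x).hasDerivWithinAt)
    Real.exp_injective.injOn (fun y => y⁻¹ * Real.exp (-(a / 2) * (y + 1 / y)))
  rw [image_univ, Real.range_exp] at h
  rw [h]
  simp only [Measure.restrict_univ, smul_eq_mul, Real.abs_exp]
  rw [← mul_assoc, show (2:ℝ) * (1/2) = 1 by norm_num, one_mul]
  congr 1
  ext x
  rw [WW, Real.exp_neg, ← mul_assoc, mul_inv_cancel₀ (Real.exp_pos x).ne', one_div, one_mul]

lemma K0_Ioi (a : ℝ) : K0 a = ∫ x in Ioi (0:ℝ), WW a x := by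
  have h := integral_comp_abs (f := WW a)
  have h2 : (fun x => WW a |x|) = WW a := by
    ext x; unfold WW; rw [exp_sum_abs x]
  rw [h2, WW_integral] at h
  linarith

lemma E1_subst {z : ℝ} (hz : 0 < z) :
    ∫ u in Ioi (0:ℝ), Real.exp (-(z * Real.exp u)) = ∫ t in Ioi z, Real.exp (-t) / t := by
  have h := integral_image_eq_integral_abs_deriv_smul (s := Ioi (0:ℝ))
    (f := fun u => z * Real.exp u) (f' := fun u => z * Real.exp u)
    measurableSet_Ioi (fun x _ => ((Real.hasDerivAt_exp x).const_mul z).hasDerivWithinAt)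
    (fun x _ y _ hxy => by simpa [hz.ne'] using hxy) (fun y => Real.exp (-y) / y)
  have himg : (fun u => z * Real.exp u) '' Ioi (0:ℝ) = Ioi z := by
    ext y
    simp only [mem_image, mem_Ioi]
    constructor
    · rintro ⟨u, hu, rfl⟩
      have := Real.one_lt_exp_iff.2 hu
      nlinarith
    · intro hy
      refine ⟨Real.log (y / z), Real.log_pos ((one_lt_div hz).2 hy), ?_⟩
      rw [Real.exp_log (div_pos (hz.trans hy) hz)]
      field_simp
  rw [himg] at h
  rw [h]
  congr 1
  ext u
  have : 0 < z * Real.exp u := by positivity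
  rw [abs_of_pos this, smul_eq_mul]
  field_simp

lemma E1_int {z : ℝ} (hz : 0 < z) : IntegrableOn (fun t => Real.exp (-t) / t) (Ioi z) := by
  have h : IntegrableOn (fun t => Real.exp (-t) * z⁻¹) (Ioi z) :=
    (integrableOn_exp_neg_Ioi z).mul_const _
  refine Integrable.mono' h ?_ ?_
  · apply Measurable.aestronglyMeasurable; fun_prop
  · filter_upwards [self_mem_ae_restrict measurableSet_Ioi] with t ht
    have ht' : z < t := ht
    rw [Real.norm_eq_abs, abs_of_nonneg (div_nonneg (Real.exp_pos _).le (hz.trans ht').le),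
      div_eq_mul_inv]
    gcongr

lemma tendsto_exp_log : Tendsto (fun t : ℝ => -(Real.exp (-t) * Real.log t)) atTop (𝓝 0) := by
  have h := Real.tendsto_pow_mul_exp_neg_atTop_nhds_zero 1
  have : Tendsto (fun t : ℝ => (Real.exp (-t) * Real.log t)) atTop (𝓝 0) := by
    refine squeeze_zero' ?_ ?_ h
    · filter_upwards [eventually_ge_atTop 1] with t ht
      exact mul_nonneg (Real.exp_pos _).le (Real.log_nonneg ht)
    · filter_upwards [eventually_ge_atTop 1] with t ht
      rw [pow_one, mul_comm]
      gcongr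
      exact Real.log_le_self (by linarith)
  simpa using this.neg

lemma E1_parts {z : ℝ} (hz : 0 < z) :
    ∫ t in Ioi z, Real.exp (-t) / t =
      (∫ t in Ioi z, Real.log t * Real.exp (-t)) - Real.exp (-z) * Real.log z := by
  have hi1 := E1_int hz
  have hi2 : IntegrableOn (fun t => Real.log t * Real.exp (-t)) (Ioi z) :=
    aux_gam_int.mono_set (Ioi_subset_Ioi hz.le)
  have h := integral_Ioi_of_hasDerivAt_of_tendsto' (a := z)
    (f := fun t : ℝ => -(Real.exp (-t) * Real.log t))
    (f' := fun t => Real.log t * Real.exp (-t) - Real.exp (-t) / t) (m := 0) ?_ (hi2.sub hi1)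
    tendsto_exp_log
  · rw [integral_sub hi2 hi1] at h
    linarith
  · intro t ht
    have ht0 : 0 < t := lt_of_lt_of_le hz ht
    have h1 : HasDerivAt (fun t : ℝ => Real.exp (-t)) (Real.exp (-t) * (-1)) t :=
      (hasDerivAt_neg t).exp
    have h2 := (h1.mul (Real.hasDerivAt_log ht0.ne')).neg
    refine h2.congr_deriv ?_
    field_simp
    ring

lemma E1_bound {z : ℝ} (hz : 0 < z) :
    0 ≤ (∫ t in Ioi z, Real.exp (-t) / t) + Real.log z + Real.eulerMascheroniConstant ∧
    (∫ t in Ioi z, Real.exp (-t) / t) + Real.log z + Real.eulerMascheroniConstant ≤ z := by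
  have hsplit : (∫ t in Ioi (0:ℝ), Real.log t * Real.exp (-t)) =
      (∫ t in (0:ℝ)..z, Real.log t * Real.exp (-t)) + ∫ t in Ioi z, Real.log t * Real.exp (-t) := by
    rw [intervalIntegral.integral_of_le hz.le, ← setIntegral_union, Ioc_union_Ioi_eq_Ioi hz.le]
    · exact Ioc_disjoint_Ioi le_rfl
    · exact measurableSet_Ioi
    · exact aux_gam_int.mono_set Ioc_subset_Ioi_self
    · exact aux_gam_int.mono_set (Ioi_subset_Ioi hz.le)
  rw [aux_gam] at hsplit
  have hii : IntervalIntegrable (fun t => Real.log t * Real.exp (-t)) volume 0 z := by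
    rw [intervalIntegrable_iff_integrableOn_Ioc_of_le hz.le]
    exact aux_gam_int.mono_set Ioc_subset_Ioi_self
  have hexp : ∫ t in (0:ℝ)..z, Real.exp (-t) = 1 - Real.exp (-z) := by
    rw [intervalIntegral.integral_comp_neg (fun t => Real.exp t)]
    simp
  have hei : IntervalIntegrable (fun t => Real.log z * Real.exp (-t)) volume 0 z :=
    (by fun_prop : Continuous fun t => Real.log z * Real.exp (-t)).intervalIntegrable _ _
  have key : (∫ t in Ioi z, Real.exp (-t) / t) + Real.log z + Real.eulerMascheroniConstant =
      ∫ t in (0:ℝ)..z, (Real.log z * Real.exp (-t) - Real.log t * Real.exp (-t)) := by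
    rw [intervalIntegral.integral_sub hei hii, intervalIntegral.integral_const_mul, hexp,
      E1_parts hz]
    linarith
  rw [key]
  constructor
  · apply intervalIntegral.integral_nonneg_of_ae_restrict hz.le
    rw [Filter.EventuallyLE]
    have : ∀ᵐ t ∂(volume.restrict (Icc 0 z)), t ≠ 0 := 
      ae_restrict_of_ae (by simp [ae_iff])
    filter_upwards [self_mem_ae_restrict measurableSet_Icc, this] with t ht h0
    have ht0 : 0 < t := lt_of_le_of_ne ht.1 h0.symm
    have := Real.log_le_log ht0 ht.2
    have := Real.exp_pos (-t)
    simp only [Pi.zero_apply]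
    nlinarith
  · have hl : IntervalIntegrable (fun t => Real.log z - Real.log t) volume 0 z :=
      (intervalIntegrable_const).sub intervalIntegral.intervalIntegrable_log'
    have hle : ∫ t in (0:ℝ)..z, (Real.log z * Real.exp (-t) - Real.log t * Real.exp (-t)) ≤
        ∫ t in (0:ℝ)..z, (Real.log z - Real.log t) := by
      apply intervalIntegral.integral_mono_on_of_le_Ioo hz.le (hei.sub hii) hl
      intro t ht
      have h1 := Real.log_le_log ht.1 ht.2.le
      have h2 : Real.exp (-t) ≤ 1 := Real.exp_le_one_iff.2 (by linarith [ht.1])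
      nlinarith
    refine hle.trans ?_
    rw [intervalIntegral.integral_sub intervalIntegrable_const
      intervalIntegral.intervalIntegrable_log', integral_log]
    simp

lemma K0_bound {x : ℝ} (hx : 0 < x) :
    |K0 x + Real.log (x / 2) + Real.eulerMascheroniConstant| ≤ x / 2 := by
  have hz : 0 < x / 2 := by positivity
  obtain ⟨h1, h2⟩ := E1_bound hz
  rw [← E1_subst hz] at h1 h2
  have hE : IntegrableOn (fun u => Real.exp (-(x / 2 * Real.exp u))) (Ioi (0:ℝ)) := by
    refine ((integrableOn_exp_neg_Ioi 0).const_mul (x/2)⁻¹).mono' ?_ ?_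
    · apply Measurable.aestronglyMeasurable; fun_prop
    · refine ae_of_all _ fun u => ?_
      rw [Real.norm_eq_abs, Real.abs_exp, Real.exp_neg, Real.exp_neg, ← mul_inv]
      apply inv_anti₀ (by positivity)
      linarith [Real.add_one_le_exp (x / 2 * Real.exp u)]
  have hW : IntegrableOn (WW x) (Ioi (0:ℝ)) := (WW_int hx).integrableOn
  have hle : K0 x ≤ ∫ u in Ioi (0:ℝ), Real.exp (-(x / 2 * Real.exp u)) := by
    rw [K0_Ioi]
    apply integral_mono hW hE
    intro u
    apply Real.exp_le_exp.2
    have := Real.exp_pos (-u)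
    nlinarith
  have hge : (∫ u in Ioi (0:ℝ), Real.exp (-(x / 2 * Real.exp u))) - K0 x ≤ x / 2 := by
    rw [K0_Ioi, ← integral_sub hE hW]
    have : ∫ u in Ioi (0:ℝ), x / 2 * Real.exp (-u) = x / 2 := by
      rw [integral_const_mul, integral_exp_neg_Ioi_zero, mul_one]
    refine le_trans ?_ this.le
    apply integral_mono (hE.sub hW) ((integrableOn_exp_neg_Ioi 0).const_mul _)
    intro u
    have e : WW x u = Real.exp (-(x / 2 * Real.exp u)) * Real.exp (-(x / 2 * Real.exp (-u))) := by
      rw [WW, ← Real.exp_add]; congr 1; ring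
    simp only [Pi.sub_apply]
    rw [e]
    have a1 : Real.exp (-(x / 2 * Real.exp u)) ≤ 1 := Real.exp_le_one_iff.2 (by
      have := Real.exp_pos u
      nlinarith)
    have a2 := Real.one_sub_le_exp_neg (x / 2 * Real.exp (-u))
    have a3 := Real.exp_pos (-(x / 2 * Real.exp u))
    have a4 : 0 < x / 2 * Real.exp (-u) := by positivity
    nlinarith
  rw [abs_le]
  constructor <;> linarith

noncomputable def FF (s : ℝ) : ℝ := (1 + Real.exp |s|)⁻¹

lemma FF_cont : Continuous FF := by
  unfold FF
  refine Continuous.inv₀ (by fun_prop) fun s => ?_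
  positivity

lemma FF_pos (s : ℝ) : 0 < FF s := by unfold FF; positivity

lemma FF_le (s : ℝ) : FF s ≤ Real.exp (-|s|) := by
  unfold FF
  rw [Real.exp_neg]
  exact inv_anti₀ (by positivity) (by linarith)

lemma FF_le_one (s : ℝ) : FF s ≤ 1 :=
  (FF_le s).trans (Real.exp_le_one_iff.2 (by simp))

lemma conv_WW (a s : ℝ) :
    ∫ l, WW a l * WW a (s - l) = 2 * K0 (2 * a * Real.cosh (s / 2)) := by
  rw [← WW_integral, ← integral_add_right_eq_self (fun l => WW a l * WW a (s - l)) (s / 2)]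
  congr 1
  ext t
  unfold WW
  rw [← Real.exp_add]
  congr 1
  rw [Real.cosh_eq, show s - (t + s/2) = s/2 + -t by ring, show -(t+s/2) = -t + -(s/2) by ring,
    show -(s/2 + -t) = -(s/2) + t by ring]
  simp only [Real.exp_add]
  ring

lemma N_int {a : ℝ} (ha : 0 < a) :
    Integrable (fun p : ℝ × ℝ => FF p.1 * (WW a p.2 * WW a (p.1 - p.2))) (volume.prod volume) := by
  have h := (WW_int ha).convolution_integrand (ContinuousLinearMap.mul ℝ ℝ) (WW_int ha)
    (μ := volume) (ν := volume)
  refine h.bdd_mul (c := 1) (f := fun p : ℝ × ℝ => FF p.1)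
    (FF_cont.comp continuous_fst).aestronglyMeasurable ?_
  refine ae_of_all _ fun p => ?_
  rw [Real.norm_eq_abs, abs_of_pos (FF_pos _)]
  exact FF_le_one _

lemma N_int2 {a : ℝ} (ha : 0 < a) :
    Integrable (fun s => FF s * (2 * K0 (2 * a * Real.cosh (s / 2)))) := by
  have h := (N_int ha).integral_prod_left
  simpa only [integral_const_mul, conv_WW] using h

lemma N_eq {a : ℝ} (ha : 0 < a) :
    ∫ l, ∫ r, FF (l + r) * WW a l * WW a r = ∫ s, FF s * (2 * K0 (2 * a * Real.cosh (s / 2))) := by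
  have h1 : ∀ l, ∫ r, FF (l + r) * WW a l * WW a r = ∫ s, FF s * (WW a l * WW a (s - l)) := by
    intro l
    rw [← integral_add_left_eq_self (fun s => FF s * (WW a l * WW a (s - l))) l]
    congr 1
    ext r
    rw [add_sub_cancel_left, mul_assoc]
  simp_rw [h1]
  rw [← integral_integral_swap (f := fun s l => FF s * (WW a l * WW a (s - l))) (N_int ha)]
  simp_rw [integral_const_mul, conv_WW]

lemma cosh_le (s : ℝ) : Real.cosh (s / 2) ≤ Real.exp (|s| / 2) := by
  rw [← Real.cosh_abs, Real.cosh_eq, abs_div, abs_two]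
  have : Real.exp (-(|s|/2)) ≤ Real.exp (|s|/2) := Real.exp_le_exp.2 (by linarith [abs_nonneg s])
  linarith

lemma int_Fcosh : Integrable (fun s => FF s * Real.cosh (s / 2)) := by
  refine (aux_exp_abs (c := 1/2) (by norm_num)).mono' ?_ ?_
  · exact (FF_cont.mul (by fun_prop)).aestronglyMeasurable
  · refine ae_of_all _ fun s => ?_
    have := Real.cosh_pos (s/2)
    rw [Real.norm_eq_abs, abs_of_pos (mul_pos (FF_pos s) this)]
    calc FF s * Real.cosh (s / 2) ≤ Real.exp (-|s|) * Real.exp (|s| / 2) :=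
          mul_le_mul (FF_le s) (cosh_le s) this.le (Real.exp_pos _).le
      _ = _ := by rw [← Real.exp_add]; congr 1; ring

lemma int_F : Integrable FF := by
  refine int_Fcosh.mono' FF_cont.aestronglyMeasurable (ae_of_all _ fun s => ?_)
  rw [Real.norm_eq_abs, abs_of_pos (FF_pos s)]
  exact le_mul_of_one_le_right (FF_pos s).le (Real.one_le_cosh _)

lemma log_cosh_cont : Continuous (fun s : ℝ => Real.log (Real.cosh (s / 2))) :=
  Continuous.log (by fun_prop) fun s => (Real.cosh_pos _).ne'

lemma int_Flogcosh : Integrable (fun s => FF s * Real.log (Real.cosh (s / 2))) := by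
  refine int_Fcosh.mono' (FF_cont.mul log_cosh_cont).aestronglyMeasurable (ae_of_all _ fun s => ?_)
  have h := Real.log_nonneg (Real.one_le_cosh (s/2))
  rw [Real.norm_eq_abs, abs_of_nonneg (mul_nonneg (FF_pos s).le h)]
  exact mul_le_mul_of_nonneg_left (Real.log_le_self (Real.cosh_pos _).le) (FF_pos s).le

lemma hasDeriv_log1p (s : ℝ) :
    HasDerivAt (fun s : ℝ => -Real.log (1 + Real.exp (-s))) ((1 + Real.exp s)⁻¹) s := by
  have h1 : HasDerivAt (fun t : ℝ => 1 + Real.exp (-t)) (Real.exp (-s) * (-1)) s :=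
    ((hasDerivAt_neg s).exp).const_add 1
  refine (h1.log (by positivity)).neg.congr_deriv ?_
  rw [Real.exp_neg]
  field_simp
  ring

lemma tendsto_log1p : Tendsto (fun s : ℝ => -Real.log (1 + Real.exp (-s))) atTop (𝓝 0) := by
  have h : Tendsto (fun s : ℝ => 1 + Real.exp (-s)) atTop (𝓝 (1 + 0)) :=
    tendsto_const_nhds.add (Real.tendsto_exp_neg_atTop_nhds_zero)
  have := (h.log (by norm_num)).neg
  simpa using this

lemma I0_Ioi : ∫ s in Ioi (0:ℝ), (1 + Real.exp s)⁻¹ = Real.log 2 := by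
  rw [integral_Ioi_of_hasDerivAt_of_nonneg' (fun s _ => hasDeriv_log1p s)
    (fun s _ => by positivity) tendsto_log1p]
  norm_num

lemma I0_int : IntegrableOn (fun s => (1 + Real.exp s)⁻¹) (Ioi (0:ℝ)) :=
  integrableOn_Ioi_deriv_of_nonneg' (fun s _ => hasDeriv_log1p s)
    (fun s _ => by positivity) tendsto_log1p

lemma hasDeriv_log1p_sq (s : ℝ) :
    HasDerivAt (fun s : ℝ => -((-Real.log (1 + Real.exp (-s))) ^ 2 / 2))
      (Real.log (1 + Real.exp (-s)) * (1 + Real.exp s)⁻¹) s := by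
  refine (((hasDeriv_log1p s).pow 2).div_const 2).neg.congr_deriv ?_
  ring

lemma tendsto_log1p_sq :
    Tendsto (fun s : ℝ => -((-Real.log (1 + Real.exp (-s))) ^ 2 / 2)) atTop (𝓝 0) := by
  simpa using ((tendsto_log1p.pow 2).div_const 2).neg

lemma log1p_nonneg (s : ℝ) : 0 ≤ Real.log (1 + Real.exp (-s)) :=
  Real.log_nonneg (by linarith [Real.exp_pos (-s)])

lemma I2_Ioi : ∫ s in Ioi (0:ℝ), Real.log (1 + Real.exp (-s)) * (1 + Real.exp s)⁻¹ =
    (Real.log 2) ^ 2 / 2 := by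
  rw [integral_Ioi_of_hasDerivAt_of_nonneg' (fun s _ => hasDeriv_log1p_sq s)
    (fun s _ => mul_nonneg (log1p_nonneg s) (by positivity)) tendsto_log1p_sq]
  norm_num

lemma I2_int : IntegrableOn (fun s => Real.log (1 + Real.exp (-s)) * (1 + Real.exp s)⁻¹)
    (Ioi (0:ℝ)) :=
  integrableOn_Ioi_deriv_of_nonneg' (fun s _ => hasDeriv_log1p_sq s)
    (fun s _ => mul_nonneg (log1p_nonneg s) (by positivity)) tendsto_log1p_sq

lemma alt_sum : HasSum (fun n : ℕ => (-1 : ℝ) ^ n / ((n:ℝ) + 1) ^ 2) (π ^ 2 / 12) := by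
  have h := hasSum_one_div_nat_pow_mul_cos (k := 1) one_ne_zero (x := 1/2) (by norm_num)
  have hb : (Polynomial.map (algebraMap ℚ ℝ) (Polynomial.bernoulli (2 * 1))).eval (1/2) = -1/12 := by
    simp [Polynomial.bernoulli, Finset.sum_range_succ, Polynomial.eval_add, bernoulli]
    norm_num
  rw [hb] at h
  have h2 := (hasSum_nat_add_iff' 1).2 h
  have h3 := h2.neg
  have e1 : -((-1 : ℝ) ^ (1 + 1) * (2 * π) ^ (2 * 1) / 2 / ((2 * 1).factorial : ℝ) * (-1 / 12) -
      ∑ i ∈ Finset.range 1, 1 / (i : ℝ) ^ (2 * 1) * Real.cos (2 * π * i * (1 / 2))) = π ^ 2 / 12 := by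
    simp
    ring
  rw [e1] at h3
  refine (congrArg (fun f : ℕ → ℝ => HasSum f (π ^ 2 / 12)) (funext fun n => ?_)).mpr h3
  have e2 : Real.cos (2 * π * ((n + 1 : ℕ) : ℝ) * (1/2)) = (-1) ^ (n+1) := by
    rw [show 2 * π * ((n + 1 : ℕ) : ℝ) * (1/2) = ((n+1 : ℕ) : ℝ) * π by ring, Real.cos_nat_mul_pi]
  rw [e2]
  push_cast
  rw [pow_succ]
  ring

lemma I1_term (n : ℕ) : ∫ s in Ioi (0:ℝ), s * Real.exp (-(((n:ℝ)+1) * s)) = 1 / ((n:ℝ) + 1) ^ 2 := by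
  have h := Real.integral_rpow_mul_exp_neg_mul_Ioi (a := 2) (r := (n:ℝ)+1) (by norm_num)
    (by positivity)
  norm_num at h
  rw [h]
  simp

lemma I1_term_int (n : ℕ) :
    IntegrableOn (fun s => s * Real.exp (-(((n:ℝ)+1) * s))) (Ioi (0:ℝ)) := by
  apply Integrable.of_integral_ne_zero
  rw [I1_term]
  positivity

lemma I1_Ioi : ∫ s in Ioi (0:ℝ), s * (1 + Real.exp s)⁻¹ = π ^ 2 / 12 := by
  have hS := hasSum_integral_of_summable_integral_norm (μ := volume.restrict (Ioi (0:ℝ)))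
    (F := fun (n : ℕ) s => (-1 : ℝ) ^ n * (s * Real.exp (-(((n:ℝ)+1) * s))))
    (fun n => (I1_term_int n).const_mul _) ?_
  · simp_rw [integral_const_mul, I1_term] at hS
    have h2 := alt_sum.unique (by simpa [div_eq_mul_inv] using hS)
    rw [h2]
    apply setIntegral_congr_fun measurableSet_Ioi
    intro s hs
    have hs' : 0 < s := hs
    have hlt : Real.exp (-s) < 1 := by rw [Real.exp_lt_one_iff]; linarith
    have hg := hasSum_geometric_of_abs_lt_one (r := -Real.exp (-s))
      (by rwa [abs_neg, Real.abs_exp])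
    have hg2 := hg.mul_left (s * Real.exp (-s))
    have e : ∀ n : ℕ, s * Real.exp (-s) * (-Real.exp (-s)) ^ n =
        (-1 : ℝ) ^ n * (s * Real.exp (-(((n:ℝ)+1) * s))) := by
      intro n
      rw [neg_pow, ← Real.exp_nat_mul, show -(((n:ℝ)+1) * s) = -s + n * (-s) by ring, Real.exp_add]
      ring
    simp_rw [e] at hg2
    simp only [← div_eq_mul_inv]
    have := hg2.tsum_eq
    simp only [div_eq_mul_inv] at *
    refine Eq.trans ?_ this.symm
    rw [Real.exp_neg, sub_neg_eq_add]
    have h0 := Real.exp_pos s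
    have h1 : 1 + Real.exp s ≠ 0 := by positivity
    have h2 : 1 + (Real.exp s)⁻¹ ≠ 0 := by positivity
    field_simp
    ring
  · have : ∀ n : ℕ, ∫ s in Ioi (0:ℝ), ‖(-1 : ℝ) ^ n * (s * Real.exp (-(((n:ℝ)+1) * s)))‖ =
        1 / ((n:ℝ) + 1) ^ 2 := by
      intro n
      rw [← I1_term]
      apply setIntegral_congr_fun measurableSet_Ioi
      intro s hs
      have hs' : 0 < s := hs
      simp [abs_of_pos hs']
    simp_rw [this]
    have := (summable_nat_add_iff 1).2 (Real.summable_one_div_nat_pow.2 (one_lt_two))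
    simpa using this

lemma I1_int : IntegrableOn (fun s => s * (1 + Real.exp s)⁻¹) (Ioi (0:ℝ)) := by
  apply Integrable.of_integral_ne_zero
  rw [I1_Ioi]
  positivity

lemma IF : ∫ s, FF s = 2 * Real.log 2 := by
  have := integral_comp_abs (f := fun s => (1 + Real.exp s)⁻¹)
  rw [I0_Ioi] at this
  exact this

lemma IFlog : ∫ s, FF s * Real.log (Real.cosh (s / 2)) =
    2 * (π ^ 2 / 24 - (Real.log 2) ^ 2 / 2) := by
  have h := integral_comp_abs (f := fun s => (1 + Real.exp s)⁻¹ * Real.log (Real.cosh (s / 2)))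
  have e : ∀ s : ℝ, Real.cosh (|s| / 2) = Real.cosh (s / 2) := fun s => by
    rw [← Real.cosh_abs (s/2), abs_div, abs_two]
  simp_rw [e] at h
  refine h.trans ?_
  congr 1
  have e2 : ∀ s : ℝ, (1 + Real.exp s)⁻¹ * Real.log (Real.cosh (s / 2)) =
      (1/2) * (s * (1 + Real.exp s)⁻¹) + Real.log (1 + Real.exp (-s)) * (1 + Real.exp s)⁻¹
        - Real.log 2 * (1 + Real.exp s)⁻¹ := by
    intro s
    have : Real.cosh (s/2) = Real.exp (s/2) * (1 + Real.exp (-s)) / 2 := by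
      rw [Real.cosh_eq, mul_add, ← Real.exp_add]; congr 2
      · ring
      · congr 1; ring
    rw [this, Real.log_div (by positivity) (by norm_num), Real.log_mul (by positivity)
      (by positivity), Real.log_exp]
    ring
  simp_rw [e2]
  have i1 := I1_int.const_mul (1/2)
  have i3 := I0_int.const_mul (Real.log 2)
  have i12 : Integrable (fun s : ℝ => (1/2) * (s * (1 + Real.exp s)⁻¹) +
      Real.log (1 + Real.exp (-s)) * (1 + Real.exp s)⁻¹) (volume.restrict (Ioi 0)) := i1.add I2_int
  rw [integral_sub i12 i3, integral_add i1 I2_int, integral_const_mul,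
    integral_const_mul, I0_Ioi, I1_Ioi, I2_Ioi]
  ring

lemma N_bound : ∃ C > (0:ℝ), ∀ Γ : ℝ,
    |(∫ s, FF s * (2 * K0 (2 * Real.exp (-Γ) * Real.cosh (s / 2)))) / 4 -
      ((Γ - Real.eulerMascheroniConstant) * Real.log 2 - (π ^ 2 / 24 - (Real.log 2) ^ 2 / 2))|
      ≤ C * Real.exp (-Γ) := by
  have hpos : 0 ≤ ∫ s, FF s * Real.cosh (s / 2) :=
    integral_nonneg fun s => mul_nonneg (FF_pos s).le (Real.cosh_pos _).le
  refine ⟨(∫ s, FF s * Real.cosh (s / 2)) + 1, by linarith, fun Γ => ?_⟩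
  set ε := Real.exp (-Γ) with hε
  have hε0 : 0 < ε := Real.exp_pos _
  set g := Real.eulerMascheroniConstant
  have hint2 : Integrable (fun s => 2 * (Γ - g) * FF s - 2 * (FF s * Real.log (Real.cosh (s / 2)))) :=
    (int_F.const_mul _).sub (int_Flogcosh.const_mul _)
  have hval : ∫ s, (2 * (Γ - g) * FF s - 2 * (FF s * Real.log (Real.cosh (s / 2)))) =
      4 * ((Γ - g) * Real.log 2 - (π ^ 2 / 24 - (Real.log 2) ^ 2 / 2)) := by
    rw [integral_sub (int_F.const_mul _) (int_Flogcosh.const_mul _), integral_const_mul,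
      integral_const_mul, IF, IFlog]
    ring
  have hd := integral_sub (N_int2 hε0) hint2
  have hb : |∫ s, (FF s * (2 * K0 (2 * ε * Real.cosh (s / 2))) -
      (2 * (Γ - g) * FF s - 2 * (FF s * Real.log (Real.cosh (s / 2)))))| ≤
      ∫ s, 2 * ε * (FF s * Real.cosh (s / 2)) := by
    rw [← Real.norm_eq_abs]
    refine norm_integral_le_of_norm_le (int_Fcosh.const_mul _) (ae_of_all _ fun s => ?_)
    have hc := Real.cosh_pos (s/2)
    have hk := K0_bound (x := 2 * ε * Real.cosh (s / 2)) (by positivity)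
    rw [show 2 * ε * Real.cosh (s / 2) / 2 = ε * Real.cosh (s / 2) by ring,
      Real.log_mul hε0.ne' hc.ne', hε, Real.log_exp, ← hε] at hk
    rw [Real.norm_eq_abs, show FF s * (2 * K0 (2 * ε * Real.cosh (s / 2))) -
      (2 * (Γ - g) * FF s - 2 * (FF s * Real.log (Real.cosh (s / 2)))) =
      2 * FF s * (K0 (2 * ε * Real.cosh (s / 2)) + (-Γ + Real.log (Real.cosh (s / 2))) + g) by ring,
      abs_mul, abs_of_pos (mul_pos two_pos (FF_pos s))]
    calc _ ≤ 2 * FF s * (ε * Real.cosh (s / 2)) :=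
          mul_le_mul_of_nonneg_left hk (mul_pos two_pos (FF_pos s)).le
      _ = _ := by ring
  rw [hd, hval, integral_const_mul] at hb
  set N := ∫ s, FF s * (2 * K0 (2 * ε * Real.cosh (s / 2)))
  set J := ∫ s, FF s * Real.cosh (s / 2)
  have : 0 ≤ J * ε := mul_nonneg hpos hε0.le
  rw [abs_le] at hb ⊢
  constructor <;> nlinarith [hb.1, hb.2]

lemma final_alg {Γ L g B c C D M ε : ℝ} (hΓ : 4 ≤ Γ) (hL0 : 0.69 < L) (hL1 : L < 0.7)
    (hg0 : 1/2 < g) (hg1 : g < 2/3) (hε0 : 0 < ε) (hε : ε * Γ ≤ 1) (hC : 0 < C)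
    (hB : B = c + 2 * L * (L - g))
    (hD : |D - (Γ + L - g)| ≤ ε / 2) (hM : |M - (Γ * L - c)| ≤ C * ε) :
    |M / D ^ 2 - L / Γ + B / Γ ^ 2| ≤ 4 * (C + 2 * L + 3 * |B|) / Γ ^ 3 := by
  have hε4 : ε ≤ 1/4 := by nlinarith
  obtain ⟨δ, hδ⟩ : ∃ δ, δ = D - (Γ + L - g) := ⟨_, rfl⟩
  obtain ⟨η, hη⟩ : ∃ η, η = M - (Γ * L - c) := ⟨_, rfl⟩
  rw [← hδ] at hD
  rw [← hη] at hM
  have hΓ0 : 0 < Γ := by linarith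
  have hD' := abs_le.1 hD
  obtain ⟨d, hd⟩ : ∃ d, d = L - g + δ := ⟨_, rfl⟩
  have hd1 : |d| ≤ 1 := abs_le.2 ⟨by linarith, by linarith⟩
  have hDd : D = Γ + d := by linarith
  have hDlow : Γ / 2 ≤ D := by linarith [(abs_le.1 hd1).1]
  have hD0 : 0 < D := by linarith
  have hMe : M = Γ * L - c + η := by linarith
  have hnum : M * Γ ^ 2 - L * Γ * D ^ 2 + B * D ^ 2 =
      Γ ^ 2 * η - Γ ^ 2 * (2 * L * δ) - L * Γ * d ^ 2 + B * (2 * Γ * d + d ^ 2) := by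
    rw [hMe, hDd, hB]
    have : δ = d - (L - g) := by linarith
    rw [this]; ring
  have hd2 : d ^ 2 ≤ 1 := by rw [← sq_abs]; nlinarith [abs_nonneg d]
  have b1 : |Γ ^ 2 * η| ≤ C * Γ := by
    rw [abs_mul, abs_of_nonneg (sq_nonneg Γ)]
    calc Γ ^ 2 * |η| ≤ Γ ^ 2 * (C * ε) := by gcongr
      _ = C * Γ * (ε * Γ) := by ring
      _ ≤ C * Γ * 1 := by gcongr
      _ = _ := by ring
  have b2 : |Γ ^ 2 * (2 * L * δ)| ≤ L * Γ := by
    rw [abs_mul, abs_of_nonneg (sq_nonneg Γ), abs_mul, abs_of_pos (by linarith : 0 < 2 * L)]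
    calc Γ ^ 2 * (2 * L * |δ|) ≤ Γ ^ 2 * (2 * L * (ε / 2)) := by gcongr
      _ = L * Γ * (ε * Γ) := by ring
      _ ≤ L * Γ * 1 := by gcongr
      _ = _ := by ring
  have b3 : |L * Γ * d ^ 2| ≤ L * Γ := by
    rw [abs_of_nonneg (by positivity)]
    have : 0 < L * Γ := by positivity
    nlinarith
  have b4 : |B * (2 * Γ * d + d ^ 2)| ≤ |B| * (3 * Γ) := by
    rw [abs_mul]
    gcongr
    calc |2 * Γ * d + d ^ 2| ≤ |2 * Γ * d| + |d ^ 2| := abs_add_le _ _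
      _ = 2 * Γ * |d| + d ^ 2 := by
        rw [abs_mul, abs_of_pos (by positivity : 0 < 2 * Γ), abs_of_nonneg (sq_nonneg d)]
      _ ≤ 2 * Γ * 1 + 1 := by gcongr
      _ ≤ 3 * Γ := by linarith
  have hn : |M * Γ ^ 2 - L * Γ * D ^ 2 + B * D ^ 2| ≤ (C + 2 * L + 3 * |B|) * Γ := by
    rw [hnum]
    rw [abs_le] at b1 b2 b3 b4 ⊢
    constructor <;> linarith [b1.1, b1.2, b2.1, b2.2, b3.1, b3.2, b4.1, b4.2]
  have hq : M / D ^ 2 - L / Γ + B / Γ ^ 2 =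
      (M * Γ ^ 2 - L * Γ * D ^ 2 + B * D ^ 2) / (D ^ 2 * Γ ^ 2) := by
    field_simp
  rw [hq, abs_div, abs_of_pos (by positivity : 0 < D ^ 2 * Γ ^ 2)]
  have hDsq : Γ ^ 2 / 4 ≤ D ^ 2 := by nlinarith
  calc _ ≤ (C + 2 * L + 3 * |B|) * Γ / (Γ ^ 2 / 4 * Γ ^ 2) := by gcongr
    _ = _ := by field_simp

lemma main_eq (Γ : ℝ) :
    (∫ l : ℝ, (∫ r : ℝ, (1 + Real.exp |l + r|)⁻¹ * pGamma Γ l * pGamma Γ r)) =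
    ((∫ s, FF s * (2 * K0 (2 * Real.exp (-Γ) * Real.cosh (s / 2)))) / 4) /
      (K0 (Real.exp (-Γ))) ^ 2 := by
  rw [← N_eq (Real.exp_pos _)]
  have : ∀ l r : ℝ, (1 + Real.exp |l + r|)⁻¹ * pGamma Γ l * pGamma Γ r =
      ((2 * K0 (Real.exp (-Γ)))⁻¹) ^ 2 *
        (FF (l + r) * WW (Real.exp (-Γ)) l * WW (Real.exp (-Γ)) r) := by
    intro l r
    unfold FF WW pGamma
    ring
  simp_rw [this, integral_const_mul]
  rw [mul_inv]
  ring

theorem final_aux :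
    ∃ C > (0 : ℝ), ∃ Γ₀ > (0 : ℝ), ∀ Γ : ℝ, Γ₀ ≤ Γ →
      |(∫ l : ℝ, (∫ r : ℝ, (1 + Real.exp |l + r|)⁻¹ * pGamma Γ l * pGamma Γ r))
          - Real.log 2 / Γ
          + (Real.pi ^ 2 / 24 + (3 / 2) * (Real.log 2) ^ 2
              - Real.eulerMascheroniConstant * Real.log 2) / Γ ^ 2|
        ≤ C / Γ ^ 3 := by
  obtain ⟨C, hC, hN⟩ := N_bound
  have hL0 := Real.log_two_gt_d9
  have hL1 := Real.log_two_lt_d9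
  have hg0 := Real.one_half_lt_eulerMascheroniConstant
  have hg1 := Real.eulerMascheroniConstant_lt_two_thirds
  have hLp : 0 < Real.log 2 := by linarith
  refine ⟨4 * (C + 2 * Real.log 2 + 3 * |Real.pi ^ 2 / 24 + (3 / 2) * (Real.log 2) ^ 2
              - Real.eulerMascheroniConstant * Real.log 2|), by positivity, 4, by norm_num,
    fun Γ hΓ => ?_⟩
  rw [main_eq]
  have hε0 := Real.exp_pos (-Γ)
  refine final_alg (g := Real.eulerMascheroniConstant) (ε := Real.exp (-Γ))
    (c := Real.eulerMascheroniConstant * Real.log 2 + (π ^ 2 / 24 - (Real.log 2) ^ 2 / 2))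
    hΓ (by linarith) (by linarith) hg0 hg1 hε0 ?_ hC (by ring) ?_ ?_
  · rw [Real.exp_neg, inv_mul_le_iff₀ (Real.exp_pos _)]
    linarith [Real.add_one_le_exp Γ]
  · have h := K0_bound hε0
    rw [Real.log_div hε0.ne' (by norm_num), Real.log_exp] at h
    convert h using 2
    ring
  · convert hN Γ using 2
    ring

end DiscAux

/-- Second-order expansion of the discrepancy integral: with `γ` the Euler–Mascheroni
constant, there exist `C > 0` and `Γ₀ > 0` such that for all `Γ ≥ Γ₀`,
`| ∫_ℝ ∫_ℝ (1 + e^{|l+r|})⁻¹ p_Γ(l) p_Γ(r) dl dr − (log 2)/Γ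
   + (π²/24 + (3/2)(log 2)² − γ log 2)/Γ² | ≤ C/Γ³`. -/
theorem discrepancy_second_order :
    ∃ C > (0 : ℝ), ∃ Γ₀ > (0 : ℝ), ∀ Γ : ℝ, Γ₀ ≤ Γ →
      |(∫ l : ℝ, (∫ r : ℝ, (1 + Real.exp |l + r|)⁻¹ * pGamma Γ l * pGamma Γ r))
          - Real.log 2 / Γ
          + (Real.pi ^ 2 / 24 + (3 / 2) * (Real.log 2) ^ 2
              - Real.eulerMascheroniConstant * Real.log 2) / Γ ^ 2|
        ≤ C / Γ ^ 3 := by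
  exact final_aux
end
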